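/- arXiv:1004.3778 — 8 statements merged into one kernel-verified Lean document; each statement's English description precedes it below -/
import Mathlib

section
/- Let A₀, B₀, C₀ > 0 and set K = A₀B₀/(3C₀). Define on [0,∞) the functions A(t) = A₀ K^{-1/3} (t+K)^{1/3}, B(t) = B₀ K^{-1/3} (t+K)^{1/3}, C(t) = C₀ K^{1/3} (t+K)^{-1/3}. Then A(0) = A₀, B(0) = B₀, C(0) = C₀, the functions are positive and differentiable, and for all t ≥ 0 they satisfy A'(t) = C(t)/B(t), B'(t) = C(t)/A(t), C'(t) = −C(t)²/(A(t)B(t)). Moreover A(t)/(A₀K^{-1/3}t^{1/3}) → 1, B(t)/(B₀K^{-1/3}t^{1/3}) → 1, and C(t)/(C₀K^{1/3}t^{-1/3}) → 1 as t → ∞. -/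
open Filter Real

/-- Shifting the argument of a power function does not change its leading asymptotics. -/
theorem tendsto_mul_add_rpow_div_mul_rpow {c : ℝ} (hc : c ≠ 0) (K p : ℝ) :
    Tendsto (fun t : ℝ => c * (t + K) ^ p / (c * t ^ p)) atTop (nhds 1) := by
  have hbase : Tendsto (fun t : ℝ => 1 + K / t) atTop (nhds 1) := by
    simpa using (tendsto_const_nhds (x := (1 : ℝ))).add (tendsto_id.const_div_atTop K)
  have hpow : Tendsto (fun t : ℝ => (1 + K / t) ^ p) atTop (nhds 1) := by
    simpa using hbase.rpow_const (p := p) (Or.inl one_ne_zero)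
  refine hpow.congr' ?_
  filter_upwards [eventually_gt_atTop 0, eventually_ge_atTop (-K)] with t ht htK
  rw [mul_div_mul_left _ _ hc, ← div_rpow (by linarith) ht.le, add_div, div_self ht.ne']

/-- The derivative of a constant multiple of a shifted power function. -/
theorem hasDerivAt_mul_add_rpow (c p : ℝ) {K t : ℝ} (h : 0 < t + K) :
    HasDerivAt (fun x : ℝ => c * (x + K) ^ p) (c * (p * ((t + K) ^ p / (t + K)))) t := by
  have h' := (((hasDerivAt_id t).add_const K).rpow_const (p := p) (Or.inl h.ne')).const_mul c
  simpa [rpow_sub_one h.ne'] using h'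

/-- The explicit solution of the Ricci flow system `A' = C/B`, `B' = C/A`,
`C' = −C²/(AB)` for diagonal left-invariant metrics on the three-dimensional Heisenberg
group `Nil³`, together with its asymptotics. -/
theorem nil3_ricci_flow_solution (A₀ B₀ C₀ K : ℝ)
    (hA₀ : 0 < A₀) (hB₀ : 0 < B₀) (hC₀ : 0 < C₀)
    (hK : K = A₀ * B₀ / (3 * C₀))
    (A B C : ℝ → ℝ)
    (hA : ∀ t, A t = A₀ * K ^ (-(1 / 3 : ℝ)) * (t + K) ^ ((1 : ℝ) / 3))
    (hB : ∀ t, B t = B₀ * K ^ (-(1 / 3 : ℝ)) * (t + K) ^ ((1 : ℝ) / 3))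
    (hC : ∀ t, C t = C₀ * K ^ ((1 : ℝ) / 3) * (t + K) ^ (-(1 / 3 : ℝ))) :
    A 0 = A₀ ∧ B 0 = B₀ ∧ C 0 = C₀ ∧
    (∀ t, 0 ≤ t → 0 < A t ∧ 0 < B t ∧ 0 < C t) ∧
    (∀ t, 0 ≤ t →
      HasDerivAt A (C t / B t) t ∧
      HasDerivAt B (C t / A t) t ∧
      HasDerivAt C (-(C t) ^ 2 / (A t * B t)) t) ∧
    Tendsto (fun t => A t / (A₀ * K ^ (-(1 / 3 : ℝ)) * t ^ ((1 : ℝ) / 3))) atTop (nhds 1) ∧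
    Tendsto (fun t => B t / (B₀ * K ^ (-(1 / 3 : ℝ)) * t ^ ((1 : ℝ) / 3))) atTop (nhds 1) ∧
    Tendsto (fun t => C t / (C₀ * K ^ ((1 : ℝ) / 3) * t ^ (-(1 / 3 : ℝ)))) atTop (nhds 1) := by
  have hKpos : 0 < K := by rw [hK]; positivity
  have hcube : ∀ x : ℝ, 0 < x → (x ^ ((1 : ℝ) / 3)) ^ 3 = x := fun x hx => by
    rw [← rpow_natCast, ← rpow_mul hx.le]; norm_num
  obtain rfl : A = _ := funext hA
  obtain rfl : B = _ := funext hB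
  obtain rfl : C = _ := funext hC
  have hk : 0 < K ^ ((1 : ℝ) / 3) := rpow_pos_of_pos hKpos _
  have hk3 := hcube K hKpos
  have hk_neg : K ^ (-(1 / 3 : ℝ)) = (K ^ ((1 : ℝ) / 3))⁻¹ := rpow_neg hKpos.le _
  have hrel : A₀ * B₀ = 3 * C₀ * (K ^ ((1 : ℝ) / 3)) ^ 3 := by
    rw [hk3, hK]; field_simp
  refine ⟨?_, ?_, ?_, ?_, ?_, ?_, ?_, ?_⟩
  · simp only [zero_add, hk_neg]; field_simp
  · simp only [zero_add, hk_neg]; field_simp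
  · simp only [zero_add, hk_neg]; field_simp
  · intro t ht
    have : 0 < t + K := by linarith
    exact ⟨by positivity, by positivity, by positivity⟩
  · intro t ht
    have hs : 0 < t + K := by linarith
    have hr : 0 < (t + K) ^ ((1 : ℝ) / 3) := rpow_pos_of_pos hs _
    have hr3 := hcube _ hs
    have hr_neg : (t + K) ^ (-(1 / 3 : ℝ)) = ((t + K) ^ ((1 : ℝ) / 3))⁻¹ := rpow_neg hs.le _
    refine ⟨(hasDerivAt_mul_add_rpow _ _ hs).congr_deriv ?_,
      (hasDerivAt_mul_add_rpow _ _ hs).congr_deriv ?_,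
      (hasDerivAt_mul_add_rpow _ _ hs).congr_deriv ?_⟩
    all_goals
      simp only [hr_neg, hk_neg]
      generalize (t + K) ^ ((1 : ℝ) / 3) = r at *
      generalize K ^ ((1 : ℝ) / 3) = k at *
      rw [← hr3]
      field_simp
      linarith
  · exact tendsto_mul_add_rpow_div_mul_rpow (by positivity) K _
  · exact tendsto_mul_add_rpow_div_mul_rpow (by positivity) K _
  · exact tendsto_mul_add_rpow_div_mul_rpow (by positivity) K _
end

section
/- Fix n ≥ 1 and N = 2n+1. Suppose g_1, …, g_{2n}, g_N : [0,∞) → (0,∞) are differentiable and satisfy the Heisenberg diagonal Ricci flow system: g_i' = g_N/g_{i+n} and g_{i+n}' = g_N/g_i for 1 ≤ i ≤ n, and g_N' = −g_N² Σ_{k=1}^n 1/(g_k g_{k+n}). Then for each 1 ≤ i ≤ n the ratio g_i(t)/g_{i+n}(t) is constant in t, and the products g_1(t)⋯g_n(t)·g_N(t) and g_{n+1}(t)⋯g_{2n}(t)·g_N(t) are constant in t. -/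
/-- A real function with vanishing derivative on `[0, ∞)` is constant there. -/
theorem eq_zero_value_of_hasDerivAt_zero {f : ℝ → ℝ}
    (hf : ∀ t, 0 ≤ t → HasDerivAt f 0 t) (t : ℝ) (ht : 0 ≤ t) : f t = f 0 :=
  constant_of_has_deriv_right_zero
    (fun x hx => (hf x hx.1).continuousAt.continuousWithinAt)
    (fun x hx => (hf x hx.1).hasDerivWithinAt) t ⟨ht, le_rfl⟩

/-- If `a k' = c / b k` for all `k ∈ s` and `c' = -c² ∑ 1 / (a k * b k)`, then
`(∏ a k) * c` has vanishing derivative. -/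
theorem hasDerivAt_prod_mul_zero {ι : Type*} (s : Finset ι) {a b : ι → ℝ → ℝ} {c : ℝ → ℝ}
    {t : ℝ} (ha : ∀ k ∈ s, a k t ≠ 0)
    (hda : ∀ k ∈ s, HasDerivAt (a k) (c t / b k t) t)
    (hdc : HasDerivAt c (-(c t) ^ 2 * ∑ k ∈ s, 1 / (a k t * b k t)) t) :
    HasDerivAt (fun x => (∏ k ∈ s, a k x) * c x) 0 t := by
  classical
  refine ((HasDerivAt.fun_finsetProd hda).mul hdc).congr_deriv ?_
  have hsum : ∑ k ∈ s, (∏ j ∈ s.erase k, a j t) • (c t / b k t) =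
      (∏ k ∈ s, a k t) * c t * ∑ k ∈ s, 1 / (a k t * b k t) := by
    rw [Finset.mul_sum]
    refine Finset.sum_congr rfl fun k hk => ?_
    have hk0 := ha k hk
    rw [← Finset.mul_prod_erase s (fun j => a j t) hk, smul_eq_mul, one_div, mul_inv,
      div_eq_mul_inv]
    field_simp
  rw [hsum]
  ring

/-- Conserved quantities of the Heisenberg diagonal Ricci flow system on `H_N ℝ`,
`N = 2n+1`: each ratio `g_i/g_{i+n}` and the products `g_1⋯g_n·g_N` and
`g_{n+1}⋯g_{2n}·g_N` are constant in `t`. -/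
theorem heisenberg_ricci_flow_conserved (n : ℕ) (hn : 1 ≤ n)
    (g : ℕ → ℝ → ℝ) (gN : ℝ → ℝ)
    (hpos : ∀ I, 1 ≤ I → I ≤ 2 * n → ∀ t, 0 ≤ t → 0 < g I t)
    (hNpos : ∀ t, 0 ≤ t → 0 < gN t)
    (hderiv : ∀ i, 1 ≤ i → i ≤ n → ∀ t, 0 ≤ t →
      HasDerivAt (g i) (gN t / g (i + n) t) t ∧
      HasDerivAt (g (i + n)) (gN t / g i t) t)
    (hderivN : ∀ t, 0 ≤ t →
      HasDerivAt gN (-(gN t) ^ 2 * ∑ k ∈ Finset.Icc 1 n, 1 / (g k t * g (k + n) t)) t) :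
    (∀ i, 1 ≤ i → i ≤ n → ∀ t, 0 ≤ t → g i t / g (i + n) t = g i 0 / g (i + n) 0) ∧
    (∀ t, 0 ≤ t →
      (∏ k ∈ Finset.Icc 1 n, g k t) * gN t = (∏ k ∈ Finset.Icc 1 n, g k 0) * gN 0) ∧
    (∀ t, 0 ≤ t →
      (∏ k ∈ Finset.Icc 1 n, g (k + n) t) * gN t =
        (∏ k ∈ Finset.Icc 1 n, g (k + n) 0) * gN 0) := by
  have hg : ∀ k ∈ Finset.Icc 1 n, ∀ t, 0 ≤ t → g k t ≠ 0 ∧ g (k + n) t ≠ 0 := by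
    intro k hk t ht
    rw [Finset.mem_Icc] at hk
    exact ⟨(hpos k hk.1 (by omega) t ht).ne', (hpos (k + n) (by omega) (by omega) t ht).ne'⟩
  refine ⟨fun i h1 h2 => ?_, ?_, ?_⟩
  · refine eq_zero_value_of_hasDerivAt_zero (f := fun t => g i t / g (i + n) t) fun t ht => ?_
    obtain ⟨hi, hin⟩ := hg i (Finset.mem_Icc.2 ⟨h1, h2⟩) t ht
    obtain ⟨hd, hdn⟩ := hderiv i h1 h2 t ht
    refine (hd.div hdn hin).congr_deriv ?_
    field_simp
    ring
  · refine eq_zero_value_of_hasDerivAt_zero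
      (f := fun t => (∏ k ∈ Finset.Icc 1 n, g k t) * gN t) fun t ht => ?_
    refine hasDerivAt_prod_mul_zero _ (b := fun k => g (k + n)) (fun k hk => (hg k hk t ht).1)
      (fun k hk => ?_) (hderivN t ht)
    rw [Finset.mem_Icc] at hk
    exact (hderiv k hk.1 hk.2 t ht).1
  · refine eq_zero_value_of_hasDerivAt_zero
      (f := fun t => (∏ k ∈ Finset.Icc 1 n, g (k + n) t) * gN t) fun t ht => ?_
    refine hasDerivAt_prod_mul_zero _ (a := fun k => g (k + n)) (b := g)
      (fun k hk => (hg k hk t ht).2) (fun k hk => ?_) ?_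
    · rw [Finset.mem_Icc] at hk
      exact (hderiv k hk.1 hk.2 t ht).2
    · refine (hderivN t ht).congr_deriv ?_
      congr 1
      exact Finset.sum_congr rfl fun k _ => by rw [mul_comm]
end

section
/- Fix n ≥ 1 and N = 2n+1. Suppose g_1, …, g_{2n}, g_N : [0,∞) → (0,∞) are differentiable and satisfy the Heisenberg diagonal Ricci flow system: g_i' = g_N/g_{i+n} and g_{i+n}' = g_N/g_i for 1 ≤ i ≤ n, and g_N' = −g_N² Σ_{k=1}^n 1/(g_k g_{k+n}). Let Σ(0) = Σ_{k=1}^n 1/(g_k(0) g_{k+n}(0)). Then for all t ≥ 0, g_N(t) ≥ 1/(g_N(0)^{-1} + Σ(0) t). -/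
/-- A function with nonnegative derivative on `[0, ∞)` is bounded below by its initial value. -/
lemma le_of_hasDerivAt_nonneg {f f' : ℝ → ℝ} (hf : ∀ t, 0 ≤ t → HasDerivAt f (f' t) t)
    (hf' : ∀ t, 0 ≤ t → 0 ≤ f' t) {t : ℝ} (ht : 0 ≤ t) : f 0 ≤ f t := by
  have hmono : MonotoneOn f (Set.Ici 0) := by
    refine monotoneOn_of_hasDerivWithinAt_nonneg (f' := f') (convex_Ici 0)
      (fun x hx => (hf x hx).continuousAt.continuousWithinAt)
      (fun x hx => (hf x (interior_subset hx)).hasDerivWithinAt)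
      (fun x hx => hf' x (interior_subset hx))
  exact hmono Set.self_mem_Ici ht ht


/-- Lower bound for `g_N` under the Heisenberg diagonal Ricci flow system on `H_N ℝ`,
`N = 2n+1`: with `Σ(0) = Σ_{k=1}^n 1/(g_k(0) g_{k+n}(0))`, one has
`g_N(t) ≥ 1/(g_N(0)⁻¹ + Σ(0) t)` for all `t ≥ 0`. -/
theorem heisenberg_ricci_flow_gN_lower_bound (n : ℕ) (hn : 1 ≤ n)
    (g : ℕ → ℝ → ℝ) (gN : ℝ → ℝ)
    (hpos : ∀ I, 1 ≤ I → I ≤ 2 * n → ∀ t, 0 ≤ t → 0 < g I t)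
    (hNpos : ∀ t, 0 ≤ t → 0 < gN t)
    (hderiv : ∀ i, 1 ≤ i → i ≤ n → ∀ t, 0 ≤ t →
      HasDerivAt (g i) (gN t / g (i + n) t) t ∧
      HasDerivAt (g (i + n)) (gN t / g i t) t)
    (hderivN : ∀ t, 0 ≤ t →
      HasDerivAt gN (-(gN t) ^ 2 * ∑ k ∈ Finset.Icc 1 n, 1 / (g k t * g (k + n) t)) t) :
    ∀ t, 0 ≤ t →
      gN t ≥ 1 / ((gN 0)⁻¹ + (∑ k ∈ Finset.Icc 1 n, 1 / (g k 0 * g (k + n) 0)) * t) := by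
  have hanti : ∀ t, 0 ≤ t → ∑ k ∈ Finset.Icc 1 n, 1 / (g k t * g (k + n) t) ≤
      ∑ k ∈ Finset.Icc 1 n, 1 / (g k 0 * g (k + n) 0) := by
    intro t ht
    refine Finset.sum_le_sum fun k hk => ?_
    obtain ⟨hk1, hkn⟩ := Finset.mem_Icc.mp hk
    have hpos₁ : ∀ s, 0 ≤ s → 0 < g k s := hpos k hk1 (by omega)
    have hpos₂ : ∀ s, 0 ≤ s → 0 < g (k + n) s := hpos (k + n) (by omega) (by omega)
    have hle₁ : g k 0 ≤ g k t := le_of_hasDerivAt_nonneg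
      (fun s hs => (hderiv k hk1 hkn s hs).1)
      (fun s hs => (div_pos (hNpos s hs) (hpos₂ s hs)).le) ht
    have hle₂ : g (k + n) 0 ≤ g (k + n) t := le_of_hasDerivAt_nonneg
      (fun s hs => (hderiv k hk1 hkn s hs).2)
      (fun s hs => (div_pos (hNpos s hs) (hpos₁ s hs)).le) ht
    exact one_div_le_one_div_of_le (mul_pos (hpos₁ 0 le_rfl) (hpos₂ 0 le_rfl))
      (mul_le_mul hle₁ hle₂ (hpos₂ 0 le_rfl).le (hpos₁ t ht).le)
  intro t ht
  set S := ∑ k ∈ Finset.Icc 1 n, 1 / (g k 0 * g (k + n) 0)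
  have hinv : S * 0 - (gN 0)⁻¹ ≤ S * t - (gN t)⁻¹ := by
    refine le_of_hasDerivAt_nonneg (f := fun s => S * s - (gN s)⁻¹)
      (f' := fun s => S - ∑ k ∈ Finset.Icc 1 n, 1 / (g k s * g (k + n) s))
      (fun s hs => ?_) (fun s hs => sub_nonneg.mpr (hanti s hs)) ht
    have hN := (hNpos s hs).ne'
    refine (((hasDerivAt_id s).const_mul S).sub ((hderivN s hs).inv hN)).congr_deriv ?_
    rw [neg_mul, neg_neg, mul_div_cancel_left₀ _ (pow_ne_zero 2 hN), mul_one]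
  have hinv_pos : 0 < (gN t)⁻¹ := inv_pos.mpr (hNpos t ht)
  have hle : (gN t)⁻¹ ≤ (gN 0)⁻¹ + S * t := by linarith
  simpa using one_div_le_one_div_of_le hinv_pos hle
end

section
/- Fix n ≥ 1 and N = 2n+1. Suppose g_1, …, g_{2n}, g_N : [0,∞) → (0,∞) are differentiable and satisfy the Heisenberg diagonal Ricci flow system: g_i' = g_N/g_{i+n} and g_{i+n}' = g_N/g_i for 1 ≤ i ≤ n, and g_N' = −g_N² Σ_{k=1}^n 1/(g_k g_{k+n}). Set A_i = g_i(0)/g_{i+n}(0), B_{i+n} = g_{i+n}(0)/g_i(0), and C = g_1(0)⋯g_{2n}(0)·g_N(0)². Then as t → ∞: g_i(t)/( (n+2)^{1/(n+2)} A_i^{1/2} C^{1/(2(n+2))} t^{1/(n+2)} ) → 1 for each 1 ≤ i ≤ n; g_{i+n}(t)/( (n+2)^{1/(n+2)} B_{i+n}^{1/2} C^{1/(2(n+2))} t^{1/(n+2)} ) → 1 for each 1 ≤ i ≤ n; and g_N(t)/( (n+2)^{-n/(n+2)} C^{1/(n+2)} t^{-n/(n+2)} ) → 1. -/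
open Filter Real

/-- A real function whose derivative vanishes on `[0, ∞)` keeps its initial value. -/
lemma eq_initial_of_hasDerivAt_zero {f : ℝ → ℝ}
    (hf : ∀ t, 0 ≤ t → HasDerivAt f 0 t) {t : ℝ} (ht : 0 ≤ t) : f t = f 0 :=
  constant_of_has_deriv_right_zero
    (fun x hx => (hf x hx.1).continuousAt.continuousWithinAt)
    (fun x hx => (hf x hx.1).hasDerivWithinAt) t ⟨ht, le_rfl⟩

/-- A lower bound on the derivative on `[0, ∞)` gives linear growth. -/
lemma add_mul_le_of_le_hasDerivAt {f f' : ℝ → ℝ} {c : ℝ}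
    (hf : ∀ t, 0 ≤ t → HasDerivAt f (f' t) t) (hc : ∀ t, 0 ≤ t → c ≤ f' t)
    {t : ℝ} (ht : 0 ≤ t) : f 0 + c * t ≤ f t := by
  have hd : ∀ x, 0 ≤ x → HasDerivAt (fun x => f x - c * x) (f' x - c) x := fun x hx => by
    simpa only [id, mul_one] using (hf x hx).fun_sub ((hasDerivAt_id x).const_mul c)
  have hmono : MonotoneOn (fun x => f x - c * x) (Set.Ici 0) := by
    refine monotoneOn_of_deriv_nonneg (convex_Ici 0)
      (fun x hx => (hd x hx).continuousAt.continuousWithinAt) ?_ ?_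
    · intro x hx
      exact (hd x (interior_subset hx)).differentiableAt.differentiableWithinAt
    · intro x hx
      rw [(hd x (interior_subset hx)).deriv]
      exact sub_nonneg.2 (hc x (interior_subset hx))
  have h := hmono (Set.mem_Ici.2 le_rfl) (Set.mem_Ici.2 ht) ht
  simp only [mul_zero, sub_zero] at h
  linarith

/-- An upper bound on the derivative on `[0, ∞)` limits growth to be at most linear. -/
lemma le_add_mul_of_hasDerivAt_le {f f' : ℝ → ℝ} {c : ℝ}
    (hf : ∀ t, 0 ≤ t → HasDerivAt f (f' t) t) (hc : ∀ t, 0 ≤ t → f' t ≤ c)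
    {t : ℝ} (ht : 0 ≤ t) : f t ≤ f 0 + c * t := by
  have h := add_mul_le_of_le_hasDerivAt (f := fun x => -f x) (f' := fun x => -f' x) (c := -c)
    (fun x hx => (hf x hx).neg) (fun x hx => neg_le_neg (hc x hx)) ht
  linarith

lemma prod_Icc_two_mul (f : ℕ → ℝ) (n : ℕ) :
    ∏ k ∈ Finset.Icc 1 (2 * n), f k = ∏ k ∈ Finset.Icc 1 n, f k * f (k + n) := by
  have h1 : ∀ m, ∏ k ∈ Finset.Icc 1 m, f k = ∏ k ∈ Finset.range m, f (k + 1) := fun m => by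
    rw [Finset.range_eq_Ico, Finset.prod_Ico_add' f 0 m 1]; rfl
  rw [Finset.prod_mul_distrib, h1, h1, two_mul, Finset.prod_range_add]
  congr 1
  have h2 : ∏ k ∈ Finset.Icc 1 n, f (k + n) = ∏ k ∈ Finset.range n, f (k + 1 + n) := by
    rw [Finset.range_eq_Ico, Finset.prod_Ico_add' (fun k => f (k + n)) 0 n 1]; rfl
  rw [h2]
  exact Finset.prod_congr rfl fun k _ => by congr 1; ring

/-- Growth of a solution of `s' = 2 h` on `[0, ∞)`, where `h = √(C / Q)` with
`s ^ n ≤ Q ≤ (s + b) ^ n`. -/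
lemma tendsto_div_rpow_of_hasDerivAt {n : ℕ} (hn : 1 ≤ n) {s h Q : ℝ → ℝ} {b C : ℝ}
    (hb : 0 < b) (hC : 0 < C) (hs0 : s 0 = 0) (hs : ∀ t, 0 ≤ t → 0 ≤ s t)
    (hh : ∀ t, 0 ≤ t → 0 < h t) (hderiv : ∀ t, 0 ≤ t → HasDerivAt s (2 * h t) t)
    (hQ : ∀ t, 0 ≤ t → h t ^ 2 * Q t = C) (hQl : ∀ t, 0 ≤ t → s t ^ n ≤ Q t)
    (hQu : ∀ t, 0 ≤ t → Q t ≤ (s t + b) ^ n) :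
    Tendsto (fun t => s t / t ^ ((2 : ℝ) / (n + 2))) atTop
      (nhds ((((n : ℝ) + 2) * √C) ^ ((2 : ℝ) / (n + 2)))) := by
  have hn' : (1 : ℝ) ≤ n := by exact_mod_cast hn
  set m : ℝ := ((n : ℝ) + 2) / 2 with hm
  set e : ℝ := (2 : ℝ) / (n + 2) with he
  set c : ℝ := ((n : ℝ) + 2) * √C with hc
  have hc0 : 0 < c := by positivity
  have he0 : 0 < e := by positivity
  have hme : m * e = 1 := by rw [hm, he]; field_simp
  have hd : ∀ d, ∀ t, 0 ≤ t →
      HasDerivAt (fun t => (s t + d) ^ m) (((n : ℝ) + 2) * (h t * (s t + d) ^ ((n : ℝ) / 2))) t := by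
    intro d t ht
    have h1 := ((hderiv t ht).add_const d).rpow_const (p := m) (Or.inr (by rw [hm]; linarith))
    have h2 : m - 1 = (n : ℝ) / 2 := by rw [hm]; ring
    rw [h2] at h1
    convert h1 using 1
    rw [hm]; ring
  have hsq : ∀ v : ℝ, 0 ≤ v → (v ^ ((n : ℝ) / 2)) ^ 2 = v ^ n := fun v hv => by
    rw [← Real.rpow_natCast (v ^ ((n : ℝ) / 2)), ← Real.rpow_mul hv, ← Real.rpow_natCast]
    congr 1; push_cast; ring
  have hup : ∀ t, 0 ≤ t → s t ≤ (c * t) ^ e := by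
    intro t ht
    have h1 := le_add_mul_of_hasDerivAt_le (c := c) (hd 0) (fun x hx => by
      refine mul_le_mul_of_nonneg_left (Real.le_sqrt_of_sq_le ?_) (by positivity)
      rw [add_zero, mul_pow, hsq _ (hs x hx), ← hQ x hx]
      exact mul_le_mul_of_nonneg_left (hQl x hx) (sq_nonneg _)) ht
    rw [hs0, add_zero, add_zero, Real.zero_rpow (by positivity), zero_add] at h1
    have h2 := Real.rpow_le_rpow (Real.rpow_nonneg (hs t ht) _) h1 he0.le
    rwa [← Real.rpow_mul (hs t ht), hme, Real.rpow_one] at h2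
  have hlow : ∀ t, 0 ≤ t → (c * t) ^ e - b ≤ s t := by
    intro t ht
    have h1 := add_mul_le_of_le_hasDerivAt (c := c) (hd b) (fun x hx => by
      have hx' := hs x hx
      have hhx := hh x hx
      refine mul_le_mul_of_nonneg_left (Real.sqrt_le_iff.2 ⟨by positivity, ?_⟩) (by positivity)
      rw [mul_pow, hsq _ (by positivity), ← hQ x hx]
      exact mul_le_mul_of_nonneg_left (hQu x hx) (sq_nonneg _)) ht
    have hst := hs t ht
    have h0 : 0 ≤ (s 0 + b) ^ m := by rw [hs0]; positivity
    have h2 := Real.rpow_le_rpow (by positivity) (show c * t ≤ (s t + b) ^ m by linarith) he0.le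
    rw [← Real.rpow_mul (by positivity), hme, Real.rpow_one] at h2
    linarith
  have hlim : Tendsto (fun t : ℝ => c ^ e - b / t ^ e) atTop (nhds (c ^ e)) := by
    simpa using (tendsto_const_nhds (x := c ^ e)).sub
      ((tendsto_const_nhds (x := b)).div_atTop (tendsto_rpow_atTop he0))
  refine tendsto_of_tendsto_of_tendsto_of_le_of_le' hlim tendsto_const_nhds ?_ ?_
  · filter_upwards [eventually_gt_atTop 0] with t ht
    have h1 := hlow t ht.le
    rw [Real.mul_rpow hc0.le ht.le] at h1
    have : 0 < t ^ e := by positivity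
    rw [le_div_iff₀ this, sub_mul, div_mul_cancel₀ _ this.ne']
    exact h1
  · filter_upwards [eventually_gt_atTop 0] with t ht
    have h1 := hup t ht.le
    rw [Real.mul_rpow hc0.le ht.le] at h1
    rwa [div_le_iff₀ (by positivity)]

/-- If `x / y` is constant and `x * y ∼ K² t ^ (2 e)`, then `x ∼ √(x 0 / y 0) K t ^ e`. -/
lemma tendsto_div_of_ratio_eq {x y : ℝ → ℝ} {e K : ℝ} (hK : 0 < K)
    (hx : ∀ t, 0 ≤ t → 0 < x t) (hy : ∀ t, 0 ≤ t → 0 < y t)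
    (hxy : ∀ t, 0 ≤ t → x t / y t = x 0 / y 0)
    (hlim : Tendsto (fun t => x t * y t / t ^ (2 * e)) atTop (nhds (K ^ 2))) :
    Tendsto (fun t => x t / (√(x 0 / y 0) * K * t ^ e)) atTop (nhds 1) := by
  have hr : 0 < x 0 / y 0 := div_pos (hx 0 le_rfl) (hy 0 le_rfl)
  have h1 := (hlim.sqrt.div_const K)
  rw [Real.sqrt_sq hK.le, div_self hK.ne'] at h1
  refine h1.congr' ?_
  filter_upwards [eventually_gt_atTop 0] with t ht
  have hxt := hx t ht.le
  have hyt := hy t ht.le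
  have hte : 0 < t ^ e := by positivity
  have h2 : t ^ (2 * e) = (t ^ e) ^ 2 := by
    rw [mul_comm, Real.rpow_mul ht.le]; norm_cast
  have h3 : x t = √(x 0 / y 0) * √(x t * y t) := by
    rw [← Real.sqrt_mul hr.le, ← hxy t ht.le]
    have : x t / y t * (x t * y t) = x t ^ 2 := by field_simp
    rw [this, Real.sqrt_sq hxt.le]
  rw [h2, Real.sqrt_div' _ (by positivity), Real.sqrt_sq hte.le]
  have hr' := Real.sqrt_pos.2 hr
  calc √(x t * y t) / t ^ e / K
      = √(x 0 / y 0) * √(x t * y t) / (√(x 0 / y 0) * K * t ^ e) := by field_simp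
    _ = x t / (√(x 0 / y 0) * K * t ^ e) := by rw [← h3]

/-- Theorem 1.1(a): the asymptotic behavior of the Heisenberg diagonal Ricci flow on
`H_N ℝ`, `N = 2n+1`. With `A_i = g_i(0)/g_{i+n}(0)`, `B_{i+n} = g_{i+n}(0)/g_i(0)` and
`C = g_1(0)⋯g_{2n}(0)·g_N(0)²`, one has `g_i(t) ∼ (n+2)^{1/(n+2)} √A_i C^{1/(2(n+2))}
t^{1/(n+2)}`, similarly for `g_{i+n}` with `B_{i+n}`, and
`g_N(t) ∼ (n+2)^{-n/(n+2)} C^{1/(n+2)} t^{-n/(n+2)}`. -/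
theorem heisenberg_ricci_flow_asymptotics (n : ℕ) (hn : 1 ≤ n)
    (g : ℕ → ℝ → ℝ) (gN : ℝ → ℝ)
    (hpos : ∀ I, 1 ≤ I → I ≤ 2 * n → ∀ t, 0 ≤ t → 0 < g I t)
    (hNpos : ∀ t, 0 ≤ t → 0 < gN t)
    (hderiv : ∀ i, 1 ≤ i → i ≤ n → ∀ t, 0 ≤ t →
      HasDerivAt (g i) (gN t / g (i + n) t) t ∧
      HasDerivAt (g (i + n)) (gN t / g i t) t)
    (hderivN : ∀ t, 0 ≤ t →
      HasDerivAt gN (-(gN t) ^ 2 * ∑ k ∈ Finset.Icc 1 n, 1 / (g k t * g (k + n) t)) t)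
    (A B : ℕ → ℝ) (C : ℝ)
    (hA : ∀ i, A i = g i 0 / g (i + n) 0)
    (hB : ∀ i, B (i + n) = g (i + n) 0 / g i 0)
    (hC : C = (∏ k ∈ Finset.Icc 1 (2 * n), g k 0) * (gN 0) ^ 2) :
    (∀ i, 1 ≤ i → i ≤ n →
      Tendsto (fun t => g i t /
        (((n : ℝ) + 2) ^ ((1 : ℝ) / ((n : ℝ) + 2)) * (A i) ^ ((1 : ℝ) / 2) *
          C ^ ((1 : ℝ) / (2 * ((n : ℝ) + 2))) * t ^ ((1 : ℝ) / ((n : ℝ) + 2))))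
        atTop (nhds 1)) ∧
    (∀ i, 1 ≤ i → i ≤ n →
      Tendsto (fun t => g (i + n) t /
        (((n : ℝ) + 2) ^ ((1 : ℝ) / ((n : ℝ) + 2)) * (B (i + n)) ^ ((1 : ℝ) / 2) *
          C ^ ((1 : ℝ) / (2 * ((n : ℝ) + 2))) * t ^ ((1 : ℝ) / ((n : ℝ) + 2))))
        atTop (nhds 1)) ∧
    Tendsto (fun t => gN t /
        (((n : ℝ) + 2) ^ (-(n : ℝ) / ((n : ℝ) + 2)) * C ^ ((1 : ℝ) / ((n : ℝ) + 2)) *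
          t ^ (-(n : ℝ) / ((n : ℝ) + 2))))
      atTop (nhds 1) := by
  have hlo : ∀ i, 1 ≤ i → i ≤ n → ∀ t, 0 ≤ t → 0 < g i t :=
    fun i h1 h2 => hpos i h1 (by omega)
  have hhi : ∀ i, 1 ≤ i → i ≤ n → ∀ t, 0 ≤ t → 0 < g (i + n) t :=
    fun i h1 h2 => hpos (i + n) (by omega) (by omega)
  set p : ℕ → ℝ → ℝ := fun k t => g k t * g (k + n) t with hp
  have hp0 : ∀ i, 1 ≤ i → i ≤ n → ∀ t, 0 ≤ t → 0 < p i t :=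
    fun i h1 h2 t ht => mul_pos (hlo i h1 h2 t ht) (hhi i h1 h2 t ht)
  have hpd : ∀ i, 1 ≤ i → i ≤ n → ∀ t, 0 ≤ t → HasDerivAt (p i) (2 * gN t) t := by
    intro i h1 h2 t ht
    have ha := (hlo i h1 h2 t ht).ne'
    have hb := (hhi i h1 h2 t ht).ne'
    refine ((hderiv i h1 h2 t ht).1.fun_mul (hderiv i h1 h2 t ht).2).congr_deriv ?_
    field_simp
    ring
  set s : ℝ → ℝ := fun t => p 1 t - p 1 0 with hs
  have hsd : ∀ t, 0 ≤ t → HasDerivAt s (2 * gN t) t :=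
    fun t ht => (hpd 1 le_rfl hn t ht).sub_const _
  have hps : ∀ i, 1 ≤ i → i ≤ n → ∀ t, 0 ≤ t → p i t = s t + p i 0 := by
    intro i h1 h2 t ht
    have h := eq_initial_of_hasDerivAt_zero (f := fun t => p i t - s t)
      (fun x hx => by simpa only [sub_self] using (hpd i h1 h2 x hx).fun_sub (hsd x hx)) ht
    simp only [hs, sub_self, sub_zero] at h ⊢
    linarith
  have hs0 : s 0 = 0 := sub_self _
  have hsnn : ∀ t, 0 ≤ t → 0 ≤ s t := by
    intro t ht
    have h := add_mul_le_of_le_hasDerivAt (c := 0) hsd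
      (fun x hx => by have := hNpos x hx; positivity) ht
    rw [hs0] at h
    linarith
  have hratio : ∀ i, 1 ≤ i → i ≤ n → ∀ t, 0 ≤ t →
      g i t / g (i + n) t = g i 0 / g (i + n) 0 := by
    intro i h1 h2 t ht
    refine eq_initial_of_hasDerivAt_zero (f := fun t => g i t / g (i + n) t) (fun x hx => ?_) ht
    have ha := (hlo i h1 h2 x hx).ne'
    have hb := (hhi i h1 h2 x hx).ne'
    refine ((hderiv i h1 h2 x hx).1.fun_div (hderiv i h1 h2 x hx).2 hb).congr_deriv ?_
    field_simp
    ring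
  set Q : ℝ → ℝ := fun t => ∏ k ∈ Finset.Icc 1 n, p k t with hQ
  have hQpos : ∀ t, 0 ≤ t → 0 < Q t := fun t ht => Finset.prod_pos fun k hk =>
    hp0 k (Finset.mem_Icc.1 hk).1 (Finset.mem_Icc.1 hk).2 t ht
  have hC' : C = gN 0 ^ 2 * Q 0 := by rw [hC, prod_Icc_two_mul, mul_comm]
  have hC0 : 0 < C := by
    have h1 := hNpos 0 le_rfl
    have h2 := hQpos 0 le_rfl
    rw [hC']
    positivity
  have hcons : ∀ t, 0 ≤ t → gN t ^ 2 * Q t = C := by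
    have hlog : ∀ t, 0 ≤ t → Real.log (gN t ^ 2 * Q t) =
        2 * Real.log (gN t) + ∑ k ∈ Finset.Icc 1 n, Real.log (p k t) := by
      intro t ht
      rw [Real.log_mul (pow_pos (hNpos t ht) 2).ne' (hQpos t ht).ne', Real.log_pow,
        Real.log_prod fun k hk =>
          (hp0 k (Finset.mem_Icc.1 hk).1 (Finset.mem_Icc.1 hk).2 t ht).ne']
      norm_num
    intro t ht
    rw [hC']
    refine Real.log_injOn_pos (mul_pos (pow_pos (hNpos t ht) 2) (hQpos t ht))
      (mul_pos (pow_pos (hNpos 0 le_rfl) 2) (hQpos 0 le_rfl)) ?_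
    rw [hlog t ht, hlog 0 le_rfl]
    refine eq_initial_of_hasDerivAt_zero
      (f := fun t => 2 * Real.log (gN t) + ∑ k ∈ Finset.Icc 1 n, Real.log (p k t))
      (fun x hx => ?_) ht
    have hN := (hNpos x hx).ne'
    have hsum : HasDerivAt (fun t => ∑ k ∈ Finset.Icc 1 n, Real.log (p k t))
        (∑ k ∈ Finset.Icc 1 n, 2 * gN x / p k x) x :=
      HasDerivAt.fun_sum fun k hk =>
        (hpd k (Finset.mem_Icc.1 hk).1 (Finset.mem_Icc.1 hk).2 x hx).log
          (hp0 k (Finset.mem_Icc.1 hk).1 (Finset.mem_Icc.1 hk).2 x hx).ne'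
    refine ((((hderivN x hx).log hN).const_mul 2).fun_add hsum).congr_deriv ?_
    have h : ∑ k ∈ Finset.Icc 1 n, 2 * gN x / p k x =
        2 * gN x * ∑ k ∈ Finset.Icc 1 n, 1 / (g k x * g (k + n) x) := by
      rw [Finset.mul_sum]
      exact Finset.sum_congr rfl fun k _ => by rw [mul_one_div]
    rw [h]
    field_simp
    ring
  set b : ℝ := ∑ k ∈ Finset.Icc 1 n, p k 0 with hb
  have hb_le : ∀ k ∈ Finset.Icc 1 n, p k 0 ≤ b := fun k hk =>
    Finset.single_le_sum (f := fun k => p k 0)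
      (fun j hj => (hp0 j (Finset.mem_Icc.1 hj).1 (Finset.mem_Icc.1 hj).2 0 le_rfl).le) hk
  have hb0 : 0 < b :=
    (hp0 1 le_rfl hn 0 le_rfl).trans_le (hb_le 1 (Finset.mem_Icc.2 ⟨le_rfl, hn⟩))
  have hlim := tendsto_div_rpow_of_hasDerivAt hn hb0 hC0 hs0 hsnn hNpos hsd hcons
    (fun t ht => by
      have h := Finset.prod_le_prod (s := Finset.Icc 1 n) (f := fun _ => s t)
        (g := fun k => p k t) (fun _ _ => hsnn t ht) (fun k hk => by
          have hk' := Finset.mem_Icc.1 hk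
          have := hp0 k hk'.1 hk'.2 0 le_rfl
          rw [hps k hk'.1 hk'.2 t ht]
          linarith)
      simpa using h)
    (fun t ht => by
      have h := Finset.prod_le_prod (s := Finset.Icc 1 n) (f := fun k => p k t)
        (g := fun _ => s t + b)
        (fun k hk => (hp0 k (Finset.mem_Icc.1 hk).1 (Finset.mem_Icc.1 hk).2 t ht).le)
        (fun k hk => by
          have hk' := Finset.mem_Icc.1 hk
          have := hb_le k hk
          rw [hps k hk'.1 hk'.2 t ht]
          linarith)
      simpa using h)
  have hn2 : (0 : ℝ) < (n : ℝ) + 2 := by positivity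
  set e : ℝ := (1 : ℝ) / ((n : ℝ) + 2) with he
  have he0 : 0 < e := by positivity
  have h2e : (2 : ℝ) / ((n : ℝ) + 2) = 2 * e := by rw [he]; ring
  have hCe : (1 : ℝ) / (2 * ((n : ℝ) + 2)) = 1 / 2 * e := by rw [he]; field_simp
  have hNe : -(n : ℝ) / ((n : ℝ) + 2) = -(e * n) := by rw [he]; ring
  set K : ℝ := (((n : ℝ) + 2) * √C) ^ e with hK
  have hK0 : 0 < K := by positivity
  have hKeq : K = ((n : ℝ) + 2) ^ e * C ^ (1 / 2 * e) := by
    rw [hK, Real.mul_rpow hn2.le (Real.sqrt_nonneg C), Real.sqrt_eq_rpow, ← Real.rpow_mul hC0.le]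
  have hsq : ∀ x : ℝ, 0 ≤ x → x ^ (2 * e) = (x ^ e) ^ 2 := fun x hx => by
    rw [mul_comm, Real.rpow_mul hx]
    norm_cast
  rw [h2e, hsq _ (by positivity), ← hK] at hlim
  have hplim : ∀ i, 1 ≤ i → i ≤ n →
      Tendsto (fun t => p i t / t ^ (2 * e)) atTop (nhds (K ^ 2)) := by
    intro i h1 h2
    have h := hlim.add ((tendsto_const_nhds (x := p i 0)).div_atTop
      (tendsto_rpow_atTop (y := 2 * e) (by positivity)))
    rw [add_zero] at h
    refine h.congr' ?_
    filter_upwards [eventually_ge_atTop 0] with t ht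
    rw [hps i h1 h2 t ht, add_div]
  refine ⟨fun i h1 h2 => ?_, fun i h1 h2 => ?_, ?_⟩
  · have h := tendsto_div_of_ratio_eq hK0 (hlo i h1 h2) (hhi i h1 h2) (hratio i h1 h2)
      (hplim i h1 h2)
    rw [← hA i, hKeq, Real.sqrt_eq_rpow] at h
    rw [hCe]
    convert h using 3
    ring
  · have h := tendsto_div_of_ratio_eq (e := e) hK0 (hhi i h1 h2) (hlo i h1 h2)
      (fun t ht => by rw [← inv_div, hratio i h1 h2 t ht, inv_div])
      ((hplim i h1 h2).congr fun t => by rw [mul_comm (g (i + n) t)])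
    rw [← hB i, hKeq, Real.sqrt_eq_rpow] at h
    rw [hCe]
    convert h using 3
    ring
  · have h := tendsto_finsetProd (Finset.Icc 1 n) fun i hi =>
      hplim i (Finset.mem_Icc.1 hi).1 (Finset.mem_Icc.1 hi).2
    rw [Finset.prod_const, Nat.card_Icc, Nat.add_sub_cancel] at h
    have h' := (((tendsto_const_nhds (x := C)).div h (by positivity)).sqrt).div_const (√C / K ^ n)
    have hCs : 0 < √C := Real.sqrt_pos.2 hC0
    rw [← pow_mul, mul_comm 2 n, pow_mul, Real.sqrt_div' _ (by positivity),
      Real.sqrt_sq (by positivity), div_self (by positivity)] at h'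
    have hconst : ((n : ℝ) + 2) ^ (-(e * n)) * C ^ e = √C / K ^ n := by
      rw [hKeq, mul_pow, ← Real.rpow_mul_natCast hn2.le, ← Real.rpow_mul_natCast hC0.le,
        Real.rpow_neg hn2.le, Real.sqrt_eq_rpow, div_mul_eq_div_div_swap, ← Real.rpow_sub hC0,
        inv_mul_eq_div]
      congr 2
      rw [he]
      field_simp
      ring
    rw [hNe, hconst]
    refine h'.congr' ?_
    filter_upwards [eventually_gt_atTop 0] with t ht
    have hte : 0 < t ^ e := by positivity
    have hNt := hNpos t ht.le
    have hQt := hQpos t ht.le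
    have h3 : C / ∏ i ∈ Finset.Icc 1 n, p i t / t ^ (2 * e) = (gN t * (t ^ e) ^ n) ^ 2 := by
      rw [Finset.prod_div_distrib, Finset.prod_const, Nat.card_Icc, Nat.add_sub_cancel,
        hsq t ht.le, ← hcons t ht.le]
      simp only [hQ] at hQt ⊢
      field_simp
      ring
    rw [Pi.div_apply, h3, Real.sqrt_sq (by positivity), Real.rpow_neg ht.le, Real.rpow_mul_natCast ht.le]
    field_simp
end

section
/- Fix n ≥ 1 and N = 2n+1. Define on (0,∞) the functions g_i(t) = t^{1/(n+2)} for 1 ≤ i ≤ 2n and g_N(t) = (1/(n+2)) t^{-n/(n+2)}. Then these functions are positive and differentiable and satisfy the Heisenberg diagonal Ricci flow system for all t > 0: g_i'(t) = g_N(t)/g_{i+n}(t), g_{i+n}'(t) = g_N(t)/g_i(t) for 1 ≤ i ≤ n, and g_N'(t) = −g_N(t)² Σ_{k=1}^n 1/(g_k(t) g_{k+n}(t)). -/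
open Real

/-- Theorem 1.1(b), analytic content: the functions `g_i(t) = t^{1/(n+2)}`
(`1 ≤ i ≤ 2n`) and `g_N(t) = (1/(n+2)) t^{-n/(n+2)}` are positive, differentiable, and
solve the Heisenberg diagonal Ricci flow system on `(0, ∞)`.  These are the components
of the nilsoliton metric `g_∞(t)` on `H_N ℝ`, `N = 2n+1`. -/
theorem heisenberg_nilsoliton_solves_ricci_flow (n : ℕ) (hn : 1 ≤ n)
    (g : ℕ → ℝ → ℝ) (gN : ℝ → ℝ)
    (hg : ∀ I, 1 ≤ I → I ≤ 2 * n → ∀ t, g I t = t ^ ((1 : ℝ) / ((n : ℝ) + 2)))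
    (hgN : ∀ t, gN t = (1 / ((n : ℝ) + 2)) * t ^ (-(n : ℝ) / ((n : ℝ) + 2))) :
    (∀ I, 1 ≤ I → I ≤ 2 * n → ∀ t, 0 < t → 0 < g I t) ∧
    (∀ t, 0 < t → 0 < gN t) ∧
    (∀ i, 1 ≤ i → i ≤ n → ∀ t, 0 < t →
      HasDerivAt (g i) (gN t / g (i + n) t) t ∧
      HasDerivAt (g (i + n)) (gN t / g i t) t) ∧
    (∀ t, 0 < t →
      HasDerivAt gN (-(gN t) ^ 2 * ∑ k ∈ Finset.Icc 1 n, 1 / (g k t * g (k + n) t)) t) := by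
  have hderiv : ∀ I J, 1 ≤ I → I ≤ 2 * n → 1 ≤ J → J ≤ 2 * n → ∀ t, 0 < t →
      HasDerivAt (g I) (gN t / g J t) t := by
    intro I J hI hI' hJ hJ' t ht
    rw [funext (hg I hI hI'), hg J hJ hJ', hgN, mul_div_assoc, ← rpow_sub ht]
    convert hasDerivAt_rpow_const (p := 1 / ((n : ℝ) + 2)) (Or.inl ht.ne') using 3
    field_simp
    ring
  refine ⟨fun I hI hI' t ht => ?_, fun t ht => ?_, fun i hi hi' t ht => ⟨?_, ?_⟩, fun t ht => ?_⟩
  · rw [hg I hI hI']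
    positivity
  · rw [hgN]
    positivity
  · exact hderiv _ _ (by lia) (by lia) (by lia) (by lia) t ht
  · exact hderiv _ _ (by lia) (by lia) (by lia) (by lia) t ht
  · have hsum : ∑ k ∈ Finset.Icc 1 n, 1 / (g k t * g (k + n) t)
        = n * t ^ (-2 / ((n : ℝ) + 2)) := by
      rw [Finset.sum_congr rfl (g := fun _ => t ^ (-2 / ((n : ℝ) + 2)))]
      · simp
      · intro k hk
        rw [Finset.mem_Icc] at hk
        rw [hg k (by lia) (by lia), hg (k + n) (by lia) (by lia), ← rpow_add ht, one_div,
          ← rpow_neg ht.le]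
        congr 1
        ring
    have hpow : t ^ (-(n : ℝ) / ((n : ℝ) + 2) - 1)
        = (t ^ (-(n : ℝ) / ((n : ℝ) + 2))) ^ 2 * t ^ (-2 / ((n : ℝ) + 2)) := by
      rw [sq, ← rpow_add ht, ← rpow_add ht]
      congr 1
      field_simp
      ring
    rw [hsum, hgN, funext hgN]
    refine ((hasDerivAt_rpow_const (p := -(n : ℝ) / ((n : ℝ) + 2))
      (Or.inl ht.ne')).const_mul (1 / ((n : ℝ) + 2))).congr_deriv ?_
    rw [hpow]
    ring
end

section
/- Fix n ≥ 1, set N = 2n+1, and let g_1, …, g_{2n}, g_N be positive real numbers. Define structure constants c : {1,…,N}³ → ℝ by c_{i,i+n}^N = 1 and c_{i+n,i}^N = −1 for 1 ≤ i ≤ n, all other components being 0, and set a_{IJ}^K = Σ_{L,M} c_{IL}^M g_{JM} g^{KL}, where g_{PQ} = δ_{PQ} g_P and g^{PQ} = δ_{PQ}/g_P. Define R_{IJ} by the formula 4R_{IJ} = Σ_{K,M,P,Q} g^{KM} [ 2 c_{KI}^P c_{JM}^Q g_{PQ} + c_{KJ}^P c_{IM}^Q g_{PQ} − c_{KM}^P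 c_{IJ}^Q g_{PQ} − c_{KI}^P c_{PJ}^Q g_{QM} + c_{KI}^P c_{PM}^Q g_{QJ} − c_{JM}^P c_{PK}^Q g_{QI} + c_{JM}^P c_{PI}^Q g_{QK} + (a_{KJ}^P + a_{JK}^P)(a_{IM}^Q + a_{MI}^Q) g_{PQ} − (a_{KM}^P + a_{MK}^P)(a_{IJ}^Q + a_{JI}^Q) g_{PQ} ]. Then R_{IJ} = 0 whenever I ≠ J, and R_{ii} = −(1/2) g_N/g_{i+n} and R_{i+n,i+n} = −(1/2) g_N/g_i for 1 ≤ i ≤ n, and R_{NN} = (1/2) g_N² Σ_{k=1}^n 1/(g_k g_{k+n}). -/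
/-- Structure constants of the classical Heisenberg Lie algebra `𝔥_N ℝ`, `N = 2n+1`,
in the basis `E_1, …, E_{2n}, E_N`: `c_{i,i+n}^N = 1`, `c_{i+n,i}^N = −1` for
`1 ≤ i ≤ n`, and all other components vanish. -/
def heisStr (n : ℕ) (I J K : ℕ) : ℝ :=
  (if 1 ≤ I ∧ I ≤ n ∧ J = I + n ∧ K = 2 * n + 1 then 1 else 0) -
  (if 1 ≤ J ∧ J ≤ n ∧ I = J + n ∧ K = 2 * n + 1 then 1 else 0)

/-- The diagonal metric `g_{PQ} = δ_{PQ} g_P`. -/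
def heisMet (g : ℕ → ℝ) (P Q : ℕ) : ℝ := if P = Q then g P else 0

/-- The inverse diagonal metric `g^{PQ} = δ_{PQ} / g_P`. -/
noncomputable def heisInv (g : ℕ → ℝ) (P Q : ℕ) : ℝ := if P = Q then 1 / g P else 0

/-- The adjoint structure constants `a_{IJ}^K = Σ_{L,M} c_{IL}^M g_{JM} g^{KL}`. -/
noncomputable def heisAdj (n : ℕ) (g : ℕ → ℝ) (I J K : ℕ) : ℝ :=
  ∑ L ∈ Finset.Icc 1 (2 * n + 1), ∑ M ∈ Finset.Icc 1 (2 * n + 1),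
    heisStr n I L M * heisMet g J M * heisInv g K L

/-- The Ricci tensor `R_{IJ}` of a diagonal left-invariant metric on `H_N ℝ`, defined by
the general component formula for the Ricci tensor of a left-invariant metric on a Lie
group in terms of structure constants and adjoint structure constants. -/
noncomputable def heisRic (n : ℕ) (g : ℕ → ℝ) (I J : ℕ) : ℝ :=
  (1 / 4) * ∑ K ∈ Finset.Icc 1 (2 * n + 1), ∑ M ∈ Finset.Icc 1 (2 * n + 1),
    ∑ P ∈ Finset.Icc 1 (2 * n + 1), ∑ Q ∈ Finset.Icc 1 (2 * n + 1),
      heisInv g K M *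
        (2 * heisStr n K I P * heisStr n J M Q * heisMet g P Q
          + heisStr n K J P * heisStr n I M Q * heisMet g P Q
          - heisStr n K M P * heisStr n I J Q * heisMet g P Q
          - heisStr n K I P * heisStr n P J Q * heisMet g Q M
          + heisStr n K I P * heisStr n P M Q * heisMet g Q J
          - heisStr n J M P * heisStr n P K Q * heisMet g Q I
          + heisStr n J M P * heisStr n P I Q * heisMet g Q K
          + (heisAdj n g K J P + heisAdj n g J K P) *
            (heisAdj n g I M Q + heisAdj n g M I Q) * heisMet g P Q
          - (heisAdj n g K M P + heisAdj n g M K P) *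
            (heisAdj n g I J Q + heisAdj n g J I Q) * heisMet g P Q)

theorem heisStr_of_ne_center (n I J : ℕ) {K : ℕ} (h : K ≠ 2 * n + 1) : heisStr n I J K = 0 := by
  simp [heisStr, h]

theorem heisStr_antisymm (n I J K : ℕ) : heisStr n I J K = -heisStr n J I K := by
  unfold heisStr
  ring

theorem heisStr_self (n I K : ℕ) : heisStr n I I K = 0 := by
  unfold heisStr
  ring

theorem heisStr_center_left (n J K : ℕ) : heisStr n (2 * n + 1) J K = 0 := by
  unfold heisStr
  rw [if_neg (by omega), if_neg (by omega), sub_zero]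

theorem heisStr_center_right (n I K : ℕ) : heisStr n I (2 * n + 1) K = 0 := by
  rw [heisStr_antisymm, heisStr_center_left, neg_zero]

theorem heisStr_mul_heisStr (n I J K P Q : ℕ) : heisStr n I J P * heisStr n P K Q = 0 := by
  by_cases h : P = 2 * n + 1
  · rw [h, heisStr_center_left, mul_zero]
  · rw [heisStr_of_ne_center n I J h, zero_mul]

theorem heisStr_repeat_left (n I J : ℕ) : heisStr n I J I = 0 := by
  by_cases h : I = 2 * n + 1
  · rw [h, heisStr_center_left]
  · exact heisStr_of_ne_center n I J h

theorem heisAdj_eq (n : ℕ) (g : ℕ → ℝ) (I J K : ℕ) (hJ : J ∈ Finset.Icc 1 (2 * n + 1))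
    (hK : K ∈ Finset.Icc 1 (2 * n + 1)) :
    heisAdj n g I J K = heisStr n I K J * g J / g K := by
  unfold heisAdj heisMet heisInv
  rw [Finset.sum_eq_single_of_mem K hK, Finset.sum_eq_single_of_mem J hJ]
  · simp [div_eq_mul_inv]
  · intro M _ hM
    simp [hM.symm]
  · intro L _ hL
    simp [hL.symm]

/-- Since the derived algebra is central, the only terms of the Ricci formula that survive are
those in which two brackets are contracted along the same pair of slots. -/
theorem heisRic_eq_double_sum (n : ℕ) (g : ℕ → ℝ)
    (hpos : ∀ I, 1 ≤ I → I ≤ 2 * n + 1 → 0 < g I) (I J : ℕ)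
    (hI : I ∈ Finset.Icc 1 (2 * n + 1)) (hJ : J ∈ Finset.Icc 1 (2 * n + 1)) :
    heisRic n g I J = (1 / 4) * ∑ K ∈ Finset.Icc 1 (2 * n + 1),
      ∑ P ∈ Finset.Icc 1 (2 * n + 1),
        (-3 * (heisStr n K I P * heisStr n K J P * (g P / g K))
          + heisStr n I P K * heisStr n J P K * (g K / g P)
          + heisStr n K P I * heisStr n K P J * (g I * g J / (g K * g P))) := by
  unfold heisRic
  congr 1
  refine Finset.sum_congr rfl fun K hK => ?_
  rw [Finset.sum_eq_single_of_mem K hK]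
  swap
  · intro M _ hM
    simp [heisInv, hM.symm]
  refine Finset.sum_congr rfl fun P hP => ?_
  have hK0 := (hpos K (Finset.mem_Icc.1 hK).1 (Finset.mem_Icc.1 hK).2).ne'
  have hP0 := (hpos P (Finset.mem_Icc.1 hP).1 (Finset.mem_Icc.1 hP).2).ne'
  have hvanish (Q : ℕ) := And.intro (heisStr_mul_heisStr n K I J P Q) <|
    And.intro (heisStr_mul_heisStr n K I K P Q) <|
    And.intro (heisStr_mul_heisStr n J K K P Q) (heisStr_mul_heisStr n J K I P Q)
  have hself : heisAdj n g K K P = 0 := by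
    rw [heisAdj_eq n g K K P hK hP, heisStr_repeat_left, zero_mul, zero_div]
  rw [Finset.sum_eq_single_of_mem P hP]
  · obtain ⟨h₁, h₂, h₃, h₄⟩ := hvanish P
    rw [h₁, h₂, h₃, h₄, heisStr_self n K P, hself, heisAdj_eq n g K J P hJ hP,
      heisAdj_eq n g J K P hK hP, heisAdj_eq n g I K P hK hP, heisAdj_eq n g K I P hI hP,
      heisStr_antisymm n J K P, heisStr_antisymm n I K P]
    have hcross₁ : heisStr n K P J * heisStr n I P K = 0 := by
      rw [mul_comm, heisStr_mul_heisStr]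
    have hcross₂ : heisStr n J P K * heisStr n K P I = 0 := heisStr_mul_heisStr ..
    simp only [heisInv, heisMet, if_true]
    field_simp
    linear_combination (g J * g K) * hcross₁ + (g I * g K) * hcross₂
  · intro Q _ hQ
    obtain ⟨h₁, h₂, h₃, h₄⟩ := hvanish Q
    rw [h₁, h₂, h₃, h₄, hself]
    simp [heisMet, hQ.symm]

/-- The Ricci tensor splits into a contraction over the sources of the bracket and one over its
values. -/
theorem heisRic_eq (n : ℕ) (g : ℕ → ℝ)
    (hpos : ∀ I, 1 ≤ I → I ≤ 2 * n + 1 → 0 < g I) (I J : ℕ)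
    (hI : I ∈ Finset.Icc 1 (2 * n + 1)) (hJ : J ∈ Finset.Icc 1 (2 * n + 1)) :
    heisRic n g I J =
      -(1 / 2) * ∑ K ∈ Finset.Icc 1 (2 * n + 1),
        heisStr n K I (2 * n + 1) * heisStr n K J (2 * n + 1) * (g (2 * n + 1) / g K) +
      (1 / 4) * ∑ K ∈ Finset.Icc 1 (2 * n + 1), ∑ P ∈ Finset.Icc 1 (2 * n + 1),
        heisStr n K P I * heisStr n K P J * (g I * g J / (g K * g P)) := by
  have hN : 2 * n + 1 ∈ Finset.Icc 1 (2 * n + 1) := by simp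
  have h₁ (K : ℕ) : ∑ P ∈ Finset.Icc 1 (2 * n + 1),
      -3 * (heisStr n K I P * heisStr n K J P * (g P / g K)) =
      -3 * (heisStr n K I (2 * n + 1) * heisStr n K J (2 * n + 1) * (g (2 * n + 1) / g K)) := by
    refine Finset.sum_eq_single_of_mem _ hN fun P _ hP => ?_
    rw [heisStr_of_ne_center n K I hP]
    ring
  have h₂ : ∑ K ∈ Finset.Icc 1 (2 * n + 1), ∑ P ∈ Finset.Icc 1 (2 * n + 1),
      heisStr n I P K * heisStr n J P K * (g K / g P) =
      ∑ K ∈ Finset.Icc 1 (2 * n + 1),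
        heisStr n K I (2 * n + 1) * heisStr n K J (2 * n + 1) * (g (2 * n + 1) / g K) := by
    rw [Finset.sum_eq_single_of_mem _ hN]
    · refine Finset.sum_congr rfl fun K _ => ?_
      rw [heisStr_antisymm n I, heisStr_antisymm n J, neg_mul_neg]
    · intro K _ hK
      refine Finset.sum_eq_zero fun P _ => ?_
      rw [heisStr_of_ne_center n I P hK]
      ring
  rw [heisRic_eq_double_sum n g hpos I J hI hJ]
  simp only [Finset.sum_add_distrib, h₁, h₂, ← Finset.mul_sum]
  ring

/-- A Heisenberg basis vector pairs nontrivially with at most one other. -/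
theorem heisStr_mul_eq_zero_of_ne (n K : ℕ) {I J : ℕ} (h : I ≠ J) (P Q : ℕ) :
    heisStr n K I P * heisStr n K J Q = 0 := by
  unfold heisStr
  split_ifs <;> first | omega | simp

theorem heisStr_lower (n : ℕ) {i : ℕ} (h₁ : 1 ≤ i) (h₂ : i ≤ n) (J : ℕ) :
    heisStr n i J (2 * n + 1) = if J = i + n then 1 else 0 := by
  unfold heisStr
  split_ifs <;> first | omega | simp

theorem heisStr_upper (n : ℕ) {i : ℕ} (h₁ : 1 ≤ i) (h₂ : i ≤ n) (J : ℕ) :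
    heisStr n (i + n) J (2 * n + 1) = if J = i then -1 else 0 := by
  unfold heisStr
  split_ifs <;> first | omega | simp

theorem sum_Icc_two_mul_add_one (n : ℕ) (f : ℕ → ℝ) :
    ∑ K ∈ Finset.Icc 1 (2 * n + 1), f K =
      ∑ k ∈ Finset.Icc 1 n, f k + ∑ k ∈ Finset.Icc 1 n, f (k + n) + f (2 * n + 1) := by
  simp only [← Finset.Ico_add_one_right_eq_Icc]
  rw [Finset.sum_Ico_succ_top (by omega), Finset.sum_Ico_add',
    ← Finset.sum_Ico_consecutive f (show 1 ≤ n + 1 by omega) (show n + 1 ≤ 2 * n + 1 by omega)]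
  congr 4 <;> omega

/-- The natural basis of `𝔥_N ℝ` is stably Ricci-diagonal, and the diagonal Ricci
components of a diagonal metric are `R_{ii} = −(1/2) g_N/g_{i+n}`,
`R_{i+n,i+n} = −(1/2) g_N/g_i`, and `R_{NN} = (1/2) g_N² Σ_k 1/(g_k g_{k+n})`. -/
theorem heisenberg_ricci_tensor (n : ℕ) (hn : 1 ≤ n) (g : ℕ → ℝ)
    (hpos : ∀ I, 1 ≤ I → I ≤ 2 * n + 1 → 0 < g I) :
    (∀ I J, 1 ≤ I → I ≤ 2 * n + 1 → 1 ≤ J → J ≤ 2 * n + 1 → I ≠ J →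
      heisRic n g I J = 0) ∧
    (∀ i, 1 ≤ i → i ≤ n →
      heisRic n g i i = -(1 / 2) * g (2 * n + 1) / g (i + n) ∧
      heisRic n g (i + n) (i + n) = -(1 / 2) * g (2 * n + 1) / g i) ∧
    heisRic n g (2 * n + 1) (2 * n + 1) =
      (1 / 2) * (g (2 * n + 1)) ^ 2 * ∑ k ∈ Finset.Icc 1 n, 1 / (g k * g (k + n)) := by
  refine ⟨fun I J hI hI' hJ hJ' hne => ?_, fun i hi hin => ⟨?_, ?_⟩, ?_⟩
  · rw [heisRic_eq n g hpos I J (Finset.mem_Icc.2 ⟨hI, hI'⟩) (Finset.mem_Icc.2 ⟨hJ, hJ'⟩)]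
    have hprod (K P : ℕ) : heisStr n K P I * heisStr n K P J = 0 := by
      by_cases h : I = 2 * n + 1
      · rw [heisStr_of_ne_center n K P (K := J) (fun hJN => hne (h.trans hJN.symm)), mul_zero]
      · rw [heisStr_of_ne_center n K P h, zero_mul]
    simp [heisStr_mul_eq_zero_of_ne n _ hne, hprod]
  · rw [heisRic_eq n g hpos i i (by simp; omega) (by simp; omega),
      Finset.sum_eq_single_of_mem (i + n) (by simp; omega)]
    · simp only [heisStr_upper n hi hin, heisStr_of_ne_center n _ _ (show i ≠ 2 * n + 1 by omega)]
      simp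
      ring
    · intro K _ hK
      rw [heisStr_antisymm, heisStr_lower n hi hin, if_neg hK]
      simp
  · rw [heisRic_eq n g hpos (i + n) (i + n) (by simp; omega) (by simp; omega),
      Finset.sum_eq_single_of_mem i (by simp; omega)]
    · simp only [heisStr_lower n hi hin,
        heisStr_of_ne_center n _ _ (show i + n ≠ 2 * n + 1 by omega)]
      simp
      ring
    · intro K _ hK
      rw [heisStr_antisymm, heisStr_upper n hi hin, if_neg hK]
      simp
  · rw [heisRic_eq n g hpos _ _ (by simp) (by simp), sum_Icc_two_mul_add_one n fun K =>
      ∑ P ∈ Finset.Icc 1 (2 * n + 1), heisStr n K P (2 * n + 1) * heisStr n K P (2 * n + 1) *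
        (g (2 * n + 1) * g (2 * n + 1) / (g K * g P))]
    have hlow : ∀ k ∈ Finset.Icc 1 n, (∑ P ∈ Finset.Icc 1 (2 * n + 1),
        heisStr n k P (2 * n + 1) * heisStr n k P (2 * n + 1) *
          (g (2 * n + 1) * g (2 * n + 1) / (g k * g P))) =
        g (2 * n + 1) ^ 2 * (1 / (g k * g (k + n))) := by
      intro k hk
      obtain ⟨h₁, h₂⟩ := Finset.mem_Icc.1 hk
      rw [Finset.sum_eq_single_of_mem (k + n) (by simp; omega)]
      · rw [heisStr_lower n h₁ h₂, if_pos rfl]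
        ring
      · intro P _ hP
        rw [heisStr_lower n h₁ h₂, if_neg hP]
        ring
    have hupp : ∀ k ∈ Finset.Icc 1 n, (∑ P ∈ Finset.Icc 1 (2 * n + 1),
        heisStr n (k + n) P (2 * n + 1) * heisStr n (k + n) P (2 * n + 1) *
          (g (2 * n + 1) * g (2 * n + 1) / (g (k + n) * g P))) =
        g (2 * n + 1) ^ 2 * (1 / (g k * g (k + n))) := by
      intro k hk
      obtain ⟨h₁, h₂⟩ := Finset.mem_Icc.1 hk
      rw [Finset.sum_eq_single_of_mem k (by simp; omega)]
      · rw [heisStr_upper n h₁ h₂, if_pos rfl]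
        ring
      · intro P _ hP
        rw [heisStr_upper n h₁ h₂, if_neg hP]
        ring
    rw [Finset.sum_congr rfl hlow, Finset.sum_congr rfl hupp, ← Finset.mul_sum]
    simp only [heisStr_center_left, heisStr_center_right, zero_mul, Finset.sum_const_zero]
    ring
end

section
/- Fix n ≥ 2 and let g_{ij} > 0 be given for each pair 1 ≤ i < j ≤ n. Index the Lie algebra 𝔲𝔱_n ℝ by such pairs, with structure constants c_{ij,kl}^{pq} = δ_{ip}δ_{lq}δ_{jk} − δ_{kp}δ_{jq}δ_{il} (for i<j, k<l, p<q), and regard g as a diagonal metric: g_{ij,kl} = δ_{(ij),(kl)} g_{ij} with inverse g^{ij,kl} = δ_{(ij),(kl)}/g_{ij}. Define adjoint structure constants a by a_{α β}^{γ} = Σ_{λ,μ} c_{α λ}^{μ} g_{β μ} g^{γ λ} (indices α, β, γ, λ, μ ranging over pairs), and define R_{α β} by the general component formula 4R_{αβ} = Σ_{κ,μ,π,ρ} g^{κμ} [ 2 c_{κα}^{π} c_{βμ}^{ρ} g_{πρ} + c_{κβ}^{π} c_{αμ}^{ρ} g_{πρ} − c_{κμ}^{π} c_{αβ}^{ρ}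 g_{πρ} − c_{κα}^{π} c_{πβ}^{ρ} g_{ρμ} + c_{κα}^{π} c_{πμ}^{ρ} g_{ρβ} − c_{βμ}^{π} c_{πκ}^{ρ} g_{ρα} + c_{βμ}^{π} c_{πα}^{ρ} g_{ρκ} + (a_{κβ}^{π} + a_{βκ}^{π})(a_{αμ}^{ρ} + a_{μα}^{ρ}) g_{πρ} − (a_{κμ}^{π} + a_{μκ}^{π})(a_{αβ}^{ρ} + a_{βα}^{ρ}) g_{πρ} ]. Then R_{αβ} = 0 whenever α ≠ β, and for each pair (i,j) with i < j: 4 R_{ij,ij} = −2 Σ_{1 ≤ p < i} g_{pj}/g_{pi} + 2 g_{ij}² Σ_{i < q < j} 1/(g_{iq} g_{qj}) − 2 Σ_{j < r ≤ n} g_{ir}/g_{jr}. -/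
/-- The index set of the Lie algebra `𝔲𝔱_n ℝ`: pairs `(i,j)` with `1 ≤ i < j ≤ n`. -/
def utPairs (n : ℕ) : Finset (ℕ × ℕ) :=
  (Finset.Icc 1 n ×ˢ Finset.Icc 1 n).filter fun p => p.1 < p.2

/-- The structure constants of `𝔲𝔱_n ℝ`:
`c_{ij,kl}^{pq} = δ_{ip}δ_{lq}δ_{jk} − δ_{kp}δ_{jq}δ_{il}`. -/
def utStr (α β γ : ℕ × ℕ) : ℝ :=
  (if α.1 = γ.1 ∧ β.2 = γ.2 ∧ α.2 = β.1 then 1 else 0) -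
  (if β.1 = γ.1 ∧ α.2 = γ.2 ∧ α.1 = β.2 then 1 else 0)

/-- The diagonal metric `g_{ij,kl} = δ_{(ij),(kl)} g_{ij}`. -/
def utMet (g : ℕ × ℕ → ℝ) (α β : ℕ × ℕ) : ℝ := if α = β then g α else 0

/-- The inverse diagonal metric `g^{ij,kl} = δ_{(ij),(kl)} / g_{ij}`. -/
noncomputable def utInv (g : ℕ × ℕ → ℝ) (α β : ℕ × ℕ) : ℝ := if α = β then 1 / g α else 0

/-- The adjoint structure constants `a_{αβ}^{γ} = Σ_{λ,μ} c_{αλ}^{μ} g_{βμ} g^{γλ}`. -/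
noncomputable def utAdj (n : ℕ) (g : ℕ × ℕ → ℝ) (α β γ : ℕ × ℕ) : ℝ :=
  ∑ lam ∈ utPairs n, ∑ mu ∈ utPairs n, utStr α lam mu * utMet g β mu * utInv g γ lam

/-- The Ricci tensor `R_{αβ}` of a diagonal left-invariant metric on `UT_n ℝ`, defined by
the general component formula for the Ricci tensor of a left-invariant metric on a Lie
group in terms of structure constants and adjoint structure constants. -/
noncomputable def utRic (n : ℕ) (g : ℕ × ℕ → ℝ) (α β : ℕ × ℕ) : ℝ :=
  (1 / 4) * ∑ κ ∈ utPairs n, ∑ μ ∈ utPairs n, ∑ π ∈ utPairs n, ∑ ρ ∈ utPairs n,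
    utInv g κ μ *
      (2 * utStr κ α π * utStr β μ ρ * utMet g π ρ
        + utStr κ β π * utStr α μ ρ * utMet g π ρ
        - utStr κ μ π * utStr α β ρ * utMet g π ρ
        - utStr κ α π * utStr π β ρ * utMet g ρ μ
        + utStr κ α π * utStr π μ ρ * utMet g ρ β
        - utStr β μ π * utStr π κ ρ * utMet g ρ α
        + utStr β μ π * utStr π α ρ * utMet g ρ κ
        + (utAdj n g κ β π + utAdj n g β κ π) *
          (utAdj n g α μ ρ + utAdj n g μ α ρ) * utMet g π ρ
        - (utAdj n g κ μ π + utAdj n g μ κ π) *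
          (utAdj n g α β ρ + utAdj n g β α ρ) * utMet g π ρ)

theorem mem_utPairs {n : ℕ} {α : ℕ × ℕ} :
    α ∈ utPairs n ↔ 1 ≤ α.1 ∧ α.1 < α.2 ∧ α.2 ≤ n := by
  simp only [utPairs, Finset.mem_filter, Finset.mem_product, Finset.mem_Icc]
  omega

theorem fst_lt_snd_of_mem_utPairs {n : ℕ} {α : ℕ × ℕ} (h : α ∈ utPairs n) : α.1 < α.2 :=
  (mem_utPairs.1 h).2.1

theorem utStr_antisymm (α β γ : ℕ × ℕ) : utStr α β γ = -utStr β α γ := by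
  simp only [utStr]
  grind

theorem utStr_self (α γ : ℕ × ℕ) : utStr α α γ = 0 := by
  simp [utStr, eq_comm]

theorem utStr_eq_zero_of_target {α β : ℕ × ℕ} (hβ : β.1 < β.2) : utStr α β α = 0 := by
  simp only [utStr]
  split_ifs <;> first | omega | simp

/-- `ad ∘ ad` has no diagonal entries, as both factors strictly raise the height `j - i`. -/
theorem utStr_mul_utStr_cycle {κ α π β : ℕ × ℕ} (hα : α.1 < α.2) (hβ : β.1 < β.2) :
    utStr κ α π * utStr π β κ = 0 := by
  simp only [utStr]
  split_ifs <;> first | omega | simp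

theorem utStr_mul_utStr_bracket {κ α π : ℕ × ℕ} (β : ℕ × ℕ) (hκ : κ.1 < κ.2)
    (hα : α.1 < α.2) : utStr κ α π * utStr π κ β = 0 := by
  simp only [utStr]
  split_ifs <;> first | omega | simp

theorem utStr_mul_utStr_of_ne {κ α β π : ℕ × ℕ} (hκ : κ.1 < κ.2)
    (hα : α.1 < α.2) (hβ : β.1 < β.2) (h : α ≠ β) : utStr κ α π * utStr κ β π = 0 := by
  rw [Ne, Prod.ext_iff] at h
  simp only [utStr]
  split_ifs <;> first | omega | simp

theorem utStr_mul_utStr_of_ne_target {κ α β π : ℕ × ℕ} (hκ : κ.1 < κ.2)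
    (hπ : π.1 < π.2) (h : α ≠ β) : utStr κ π α * utStr κ π β = 0 := by
  rw [Ne, Prod.ext_iff] at h
  simp only [utStr]
  split_ifs <;> first | omega | simp

theorem utStr_mul_self {κ α π : ℕ × ℕ} (hκ : κ.1 < κ.2) :
    utStr κ α π * utStr κ α π =
      (if κ.1 = π.1 ∧ α.2 = π.2 ∧ κ.2 = α.1 then 1 else 0) +
      (if α.1 = π.1 ∧ κ.2 = π.2 ∧ κ.1 = α.2 then 1 else 0) := by
  simp only [utStr]
  split_ifs <;> first | omega | simp

theorem utAdj_eq {n : ℕ} (g : ℕ × ℕ → ℝ) (α : ℕ × ℕ) {β γ : ℕ × ℕ}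
    (hβ : β ∈ utPairs n) (hγ : γ ∈ utPairs n) :
    utAdj n g α β γ = utStr α γ β * g β * (1 / g γ) := by
  simp [utAdj, utMet, utInv, hβ, hγ]

theorem sum_utInv_mul {n : ℕ} (g : ℕ × ℕ → ℝ) {κ : ℕ × ℕ} (hκ : κ ∈ utPairs n)
    (F : ℕ × ℕ → ℕ × ℕ → ℕ × ℕ → ℝ) :
    ∑ μ ∈ utPairs n, ∑ π ∈ utPairs n, ∑ ρ ∈ utPairs n, utInv g κ μ * F μ π ρ =
      ∑ π ∈ utPairs n, 1 / g κ * ∑ ρ ∈ utPairs n, F κ π ρ := by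
  rw [Finset.sum_eq_single κ]
  · simp [utInv, Finset.mul_sum]
  · intro μ _ hμ
    simp [utInv, hμ.symm]
  · exact fun h => absurd hκ h

theorem four_mul_utRic (n : ℕ) (g : ℕ × ℕ → ℝ) (hpos : ∀ α ∈ utPairs n, 0 < g α)
    {α β : ℕ × ℕ} (hα : α ∈ utPairs n) (hβ : β ∈ utPairs n) :
    4 * utRic n g α β =
      -2 * ∑ κ ∈ utPairs n, ∑ π ∈ utPairs n, utStr κ α π * utStr κ β π * (g π / g κ)
      + g α * g β *
        ∑ κ ∈ utPairs n, ∑ π ∈ utPairs n, utStr κ π α * utStr κ π β * (1 / (g κ * g π)) := by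
  have hα' := fst_lt_snd_of_mem_utPairs hα
  have hβ' := fst_lt_snd_of_mem_utPairs hβ
  have key : 4 * utRic n g α β = ∑ κ ∈ utPairs n, ∑ π ∈ utPairs n,
      (-3 * (utStr κ α π * utStr κ β π * (g π / g κ))
        + g α * g β * (utStr κ π α * utStr κ π β * (1 / (g κ * g π)))
        + utStr π α κ * utStr π β κ * (g κ / g π)) := by
    rw [utRic, ← mul_assoc, show (4 : ℝ) * (1 / 4) = 1 by norm_num, one_mul]
    refine Finset.sum_congr rfl fun κ hκ => ?_
    rw [sum_utInv_mul g hκ]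
    refine Finset.sum_congr rfl fun π hπ => ?_
    have hκ' := fst_lt_snd_of_mem_utPairs hκ
    have hπ' := fst_lt_snd_of_mem_utPairs hπ
    have gκ := (hpos κ hκ).ne'
    have gπ := (hpos π hπ).ne'
    have hdiag (ρ) : utStr κ κ ρ = 0 := utStr_self κ ρ
    have hcycle (ρ) : utStr κ α π * utStr π β ρ * utMet g ρ κ = 0 := by
      obtain rfl | h := eq_or_ne ρ κ
      · rw [utStr_mul_utStr_cycle hα' hβ', zero_mul]
      · simp [utMet, h]
    have hbracket (ρ) : utStr κ α π * utStr π κ ρ = 0 := utStr_mul_utStr_bracket ρ hκ' hα'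
    have hbracket' (ρ) : utStr β κ π * utStr π κ ρ = 0 := by
      rw [utStr_antisymm β κ π, neg_mul, utStr_mul_utStr_bracket ρ hκ' hβ', neg_zero]
    have hcycle' (ρ) : utStr β κ π * utStr π α ρ * utMet g ρ κ = 0 := by
      obtain rfl | h := eq_or_ne ρ κ
      · rw [utStr_antisymm β ρ π, neg_mul, utStr_mul_utStr_cycle hβ' hα', neg_zero, zero_mul]
      · simp [utMet, h]
    have hcross : utStr π α κ * utStr κ π β = 0 := utStr_mul_utStr_bracket β hπ' hα'
    have hcross' : utStr π β κ * utStr κ π α = 0 := utStr_mul_utStr_bracket α hπ' hβ'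
    have hadj : utAdj n g κ κ π = 0 := by
      rw [utAdj_eq g κ hκ hπ, utStr_eq_zero_of_target hπ', zero_mul, zero_mul]
    simp only [hdiag, hcycle, hbracket, hbracket', hcycle', hadj]
    rw [Finset.sum_eq_single π]
    · have hself : utMet g π π = g π := by simp [utMet]
      rw [hself, utAdj_eq g κ hβ hπ, utAdj_eq g β hκ hπ, utAdj_eq g α hκ hπ, utAdj_eq g κ hα hπ,
        utStr_antisymm β κ, utStr_antisymm α κ, utStr_antisymm β π, utStr_antisymm α π]
      field_simp
      linear_combination (-g β * g κ) * hcross - (g α * g κ) * hcross'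
    · intro ρ _ hρ
      simp [utMet, hρ.symm]
    · exact fun h => absurd hπ h
  rw [key]
  simp only [Finset.sum_add_distrib, ← Finset.mul_sum]
  rw [Finset.sum_comm (f := fun κ π => utStr π α κ * utStr π β κ * (g κ / g π))]
  ring

theorem sum_utStr_mul_self (n : ℕ) (g : ℕ × ℕ → ℝ) {i j : ℕ} (hi : 1 ≤ i) (hij : i < j)
    (hj : j ≤ n) :
    ∑ κ ∈ utPairs n, ∑ π ∈ utPairs n,
        utStr κ (i, j) π * utStr κ (i, j) π * (g π / g κ) =
      ∑ p ∈ Finset.Ico 1 i, g (p, j) / g (p, i) + ∑ r ∈ Finset.Ioc j n, g (i, r) / g (j, r) := by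
  rw [← Finset.sum_product']
  trans ∑ x ∈ utPairs n ×ˢ utPairs n,
    ((if x.1.1 = x.2.1 ∧ j = x.2.2 ∧ x.1.2 = i then g x.2 / g x.1 else 0) +
      (if i = x.2.1 ∧ x.1.2 = x.2.2 ∧ x.1.1 = j then g x.2 / g x.1 else 0))
  · refine Finset.sum_congr rfl fun x hx => ?_
    rw [utStr_mul_self (fst_lt_snd_of_mem_utPairs (Finset.mem_product.1 hx).1)]
    simp only [add_mul, ite_mul, one_mul, zero_mul]
  rw [Finset.sum_add_distrib, ← Finset.sum_filter, ← Finset.sum_filter]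
  congr 1
  · refine Finset.sum_nbij' (fun x => x.1.1) (fun p => ((p, i), (p, j))) ?_ ?_ ?_ ?_ ?_ <;>
      simp only [Finset.mem_filter, Finset.mem_product, mem_utPairs, Finset.mem_Ico, Prod.forall,
        Prod.mk.injEq] <;> grind
  · refine Finset.sum_nbij' (fun x => x.1.2) (fun r => ((j, r), (i, r))) ?_ ?_ ?_ ?_ ?_ <;>
      simp only [Finset.mem_filter, Finset.mem_product, mem_utPairs, Finset.mem_Ioc, Prod.forall,
        Prod.mk.injEq] <;> grind

theorem sum_utStr_mul_self_target (n : ℕ) (g : ℕ × ℕ → ℝ) {i j : ℕ} (hi : 1 ≤ i)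
    (hj : j ≤ n) :
    ∑ κ ∈ utPairs n, ∑ π ∈ utPairs n,
        utStr κ π (i, j) * utStr κ π (i, j) * (1 / (g κ * g π)) =
      2 * ∑ q ∈ Finset.Ioo i j, 1 / (g (i, q) * g (q, j)) := by
  rw [← Finset.sum_product']
  trans ∑ x ∈ utPairs n ×ˢ utPairs n,
    ((if x.1.1 = i ∧ x.2.2 = j ∧ x.1.2 = x.2.1 then 1 / (g x.1 * g x.2) else 0) +
      (if x.2.1 = i ∧ x.1.2 = j ∧ x.1.1 = x.2.2 then 1 / (g x.1 * g x.2) else 0))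
  · refine Finset.sum_congr rfl fun x hx => ?_
    rw [utStr_mul_self (fst_lt_snd_of_mem_utPairs (Finset.mem_product.1 hx).1)]
    simp only [add_mul, ite_mul, one_mul, zero_mul]
  rw [Finset.sum_add_distrib, ← Finset.sum_filter, ← Finset.sum_filter, two_mul]
  congr 1
  · refine Finset.sum_nbij' (fun x => x.1.2) (fun q => ((i, q), (q, j))) ?_ ?_ ?_ ?_ ?_ <;>
      simp only [Finset.mem_filter, Finset.mem_product, mem_utPairs, Finset.mem_Ioo, Prod.forall,
        Prod.mk.injEq] <;> grind
  · refine Finset.sum_nbij' (fun x => x.1.1) (fun q => ((q, j), (i, q))) ?_ ?_ ?_ ?_ ?_ <;>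
      simp only [Finset.mem_filter, Finset.mem_product, mem_utPairs, Finset.mem_Ioo, Prod.forall,
        Prod.mk.injEq] <;> grind

/-- The natural basis of `𝔲𝔱_n ℝ` is stably Ricci-diagonal, and the diagonal Ricci
components of a diagonal metric are
`4 R_{ij,ij} = −2 Σ_{p<i} g_{pj}/g_{pi} + 2 g_{ij}² Σ_{i<q<j} 1/(g_{iq} g_{qj})
− 2 Σ_{j<r≤n} g_{ir}/g_{jr}`. -/
theorem ut_ricci_tensor (n : ℕ) (hn : 2 ≤ n) (g : ℕ × ℕ → ℝ)
    (hpos : ∀ α ∈ utPairs n, 0 < g α) :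
    (∀ α ∈ utPairs n, ∀ β ∈ utPairs n, α ≠ β → utRic n g α β = 0) ∧
    (∀ i j, 1 ≤ i → i < j → j ≤ n →
      4 * utRic n g (i, j) (i, j) =
        -2 * ∑ p ∈ Finset.Ico 1 i, g (p, j) / g (p, i)
        + 2 * (g (i, j)) ^ 2 * ∑ q ∈ Finset.Ioo i j, 1 / (g (i, q) * g (q, j))
        - 2 * ∑ r ∈ Finset.Ioc j n, g (i, r) / g (j, r)) := by
  refine ⟨fun α hα β hβ hne => ?_, fun i j hi hij hj => ?_⟩
  · have h := four_mul_utRic n g hpos hα hβ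
    have hα' := fst_lt_snd_of_mem_utPairs hα
    have hβ' := fst_lt_snd_of_mem_utPairs hβ
    rw [Finset.sum_eq_zero fun κ hκ => Finset.sum_eq_zero fun π _ => by
        rw [utStr_mul_utStr_of_ne (fst_lt_snd_of_mem_utPairs hκ) hα' hβ' hne, zero_mul],
      Finset.sum_eq_zero fun κ hκ => Finset.sum_eq_zero fun π hπ => by
        rw [utStr_mul_utStr_of_ne_target (fst_lt_snd_of_mem_utPairs hκ)
          (fst_lt_snd_of_mem_utPairs hπ) hne, zero_mul]] at h
    linarith
  · have hmem : (i, j) ∈ utPairs n := mem_utPairs.2 ⟨hi, hij, hj⟩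
    rw [four_mul_utRic n g hpos hmem hmem, sum_utStr_mul_self n g hi hij hj,
      sum_utStr_mul_self_target n g hi hj]
    ring
end

section
/- Let n ≥ 2. For 1 ≤ i < j ≤ n define g_{ij} : (0,∞) → ℝ by g_{ij}(t) = n^{-(j-i-1)} t^{1 - 2(j-i)/n}. Then each g_{ij} is positive and differentiable, and for all t > 0 and all 1 ≤ i < j ≤ n: g_{ij}'(t) = Σ_{1 ≤ p < i} g_{pj}(t)/g_{pi}(t) − g_{ij}(t)² Σ_{i < q < j} 1/(g_{iq}(t) g_{qj}(t)) + Σ_{j < r ≤ n} g_{ir}(t)/g_{jr}(t). -/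
open Real

/-- The coefficients `n^{-(d-1)} t^{1-2d/n}` form a geometric sequence in `d`. -/
lemma nilsoliton_coeff_eq_geometric {n d : ℕ} (hn : n ≠ 0) (hd : 1 ≤ d) {t : ℝ} (ht : 0 < t) :
    (1 / (n : ℝ) ^ (d - 1)) * t ^ ((1 : ℝ) - 2 * (d : ℝ) / (n : ℝ)) =
      n * t * (t ^ (-2 / (n : ℝ)) / n) ^ d := by
  have hn' : (n : ℝ) ≠ 0 := Nat.cast_ne_zero.mpr hn
  have hexp : (1 : ℝ) - 2 * d / n = 1 + (-2 / n) * d := by ring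
  rw [hexp, rpow_add ht, rpow_one, rpow_mul ht.le, rpow_natCast, div_pow]
  obtain ⟨k, rfl⟩ := Nat.exists_eq_add_of_le' hd
  rw [Nat.add_sub_cancel, pow_succ (n : ℝ)]
  field_simp

/-- The derivative of `n^{-(d-1)} t^{1-2d/n}`, expressed through the geometric ratio. -/
lemma hasDerivAt_nilsoliton_coeff {n d : ℕ} (hn : n ≠ 0) (hd : 1 ≤ d) {t : ℝ} (ht : 0 < t) :
    HasDerivAt (fun s : ℝ ↦ (1 / (n : ℝ) ^ (d - 1)) * s ^ ((1 : ℝ) - 2 * (d : ℝ) / (n : ℝ)))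
      ((n - 2 * d) * (t ^ (-2 / (n : ℝ)) / n) ^ d) t := by
  have hn' : (n : ℝ) ≠ 0 := Nat.cast_ne_zero.mpr hn
  refine ((hasDerivAt_rpow_const (p := (1 : ℝ) - 2 * d / n) (Or.inl ht.ne')).const_mul
    (1 / (n : ℝ) ^ (d - 1))).congr_deriv ?_
  have hgeom := nilsoliton_coeff_eq_geometric hn hd ht
  rw [rpow_sub_one ht.ne', mul_left_comm, ← mul_div_assoc, hgeom]
  field_simp

/-- Theorem 1.2, analytic content: the diagonal metrics
`g_{ij}(t) = n^{-(j-i-1)} t^{1-2(j-i)/n}` are positive, differentiable, and solve the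
diagonal Ricci flow system on the unitriangular group `UT_n ℝ` for all `t > 0`. -/
theorem ut_nilsoliton_solves_ricci_flow (n : ℕ) (hn : 2 ≤ n)
    (g : ℕ → ℕ → ℝ → ℝ)
    (hg : ∀ i j, 1 ≤ i → i < j → j ≤ n → ∀ t : ℝ,
      g i j t = (1 / (n : ℝ) ^ (j - i - 1)) * t ^ ((1 : ℝ) - 2 * ((j - i : ℕ) : ℝ) / (n : ℝ))) :
    (∀ i j, 1 ≤ i → i < j → j ≤ n → ∀ t : ℝ, 0 < t → 0 < g i j t) ∧
    (∀ i j, 1 ≤ i → i < j → j ≤ n → ∀ t : ℝ, 0 < t →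
      HasDerivAt (g i j)
        (∑ p ∈ Finset.Ico 1 i, g p j t / g p i t
          - (g i j t) ^ 2 * ∑ q ∈ Finset.Ioo i j, 1 / (g i q t * g q j t)
          + ∑ r ∈ Finset.Ioc j n, g i r t / g j r t) t) := by
  have hn0 : n ≠ 0 := by omega
  have hn' : (0 : ℝ) < n := by exact_mod_cast (by omega : 0 < n)
  have hgeom : ∀ i j, 1 ≤ i → i < j → j ≤ n → ∀ t : ℝ, 0 < t →
      g i j t = n * t * (t ^ (-2 / (n : ℝ)) / n) ^ (j - i) := fun i j hi hij hj t ht ↦ by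
    rw [hg i j hi hij hj t, nilsoliton_coeff_eq_geometric hn0 (by omega) ht]
  refine ⟨fun i j hi hij hj t ht ↦ ?_, fun i j hi hij hj t ht ↦ ?_⟩
  · rw [hgeom i j hi hij hj t ht]
    positivity
  have hderiv := hasDerivAt_nilsoliton_coeff hn0 (by omega : 1 ≤ j - i) ht
  rw [← funext (hg i j hi hij hj)] at hderiv
  refine hderiv.congr_deriv (Eq.symm ?_)
  have hw : 0 < t ^ (-2 / (n : ℝ)) / n := by positivity
  replace hgeom : ∀ i j, 1 ≤ i → i < j → j ≤ n →
      g i j t = n * t * (t ^ (-2 / (n : ℝ)) / n) ^ (j - i) :=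
    fun i j hi hij hj ↦ hgeom i j hi hij hj t ht
  generalize t ^ (-2 / (n : ℝ)) / n = w at hgeom hw ⊢
  have hleft : ∀ p ∈ Finset.Ico 1 i, g p j t / g p i t = w ^ (j - i) := fun p hp ↦ by
    rw [Finset.mem_Ico] at hp
    rw [hgeom p j (by omega) (by omega) hj, hgeom p i (by omega) (by omega) (by omega),
      show j - p = (j - i) + (i - p) by omega, pow_add]
    field_simp
  have hmid : ∀ q ∈ Finset.Ioo i j, g i j t ^ 2 * (1 / (g i q t * g q j t)) = w ^ (j - i) :=
    fun q hq ↦ by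
      rw [Finset.mem_Ioo] at hq
      rw [hgeom i j hi hij hj, hgeom i q hi (by omega) (by omega),
        hgeom q j (by omega) (by omega) hj, show j - i = (q - i) + (j - q) by omega, pow_add]
      field_simp
  have hright : ∀ r ∈ Finset.Ioc j n, g i r t / g j r t = w ^ (j - i) := fun r hr ↦ by
    rw [Finset.mem_Ioc] at hr
    rw [hgeom i r hi (by omega) (by omega), hgeom j r (by omega) (by omega) (by omega),
      show r - i = (j - i) + (r - j) by omega, pow_add]
    field_simp
  rw [Finset.mul_sum, Finset.sum_congr rfl hleft, Finset.sum_congr rfl hmid,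
    Finset.sum_congr rfl hright]
  simp only [Finset.sum_const, Nat.card_Ico, Nat.card_Ioo, Nat.card_Ioc, nsmul_eq_mul]
  rw [Nat.cast_sub hi, Nat.cast_sub (by omega : 1 ≤ j - i), Nat.cast_sub hij.le, Nat.cast_sub hj]
  push_cast
  ring
end
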